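/- Let h > 0 and define A₁ = [[1, h], [−1.5h, 1]], A₋₁ = [[1, −h], [1.5h, 1]], B = h·[0; 1] (a 2×1 matrix). Then there is no symmetric positive definite 2×2 real matrix P such that for every x ∈ ℝ² with x ≠ 0 and each θ ∈ {1, −1}, there exists u ∈ ℝ with (A_θ x + B u)ᵀ P (A_θ x + B u) − xᵀ P x < 0. -/

import Mathlib

open Matrix

/-- No quadratic common control Lyapunov function exists for the switched system
x⁺ = A_θ x + B u, θ ∈ {1,−1}, with A₁ = [[1,h],[−1.5h,1]], A₋₁ = [[1,−h],[1.5h,1]],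
B = h·[0;1]. The input column B u is encoded as u • ![0, h]. -/
theorem stmt_5 (h : ℝ) (hh : 0 < h) :
    ¬ ∃ P : Matrix (Fin 2) (Fin 2) ℝ, P.PosDef ∧ Pᵀ = P ∧
      ∀ x : Fin 2 → ℝ, x ≠ 0 →
        ∀ A ∈ ({!![1, h; -1.5 * h, 1], !![1, -h; 1.5 * h, 1]} :
            Set (Matrix (Fin 2) (Fin 2) ℝ)),
          ∃ u : ℝ,
            (A *ᵥ x + u • ![0, h]) ⬝ᵥ (P *ᵥ (A *ᵥ x + u • ![0, h]))
              - x ⬝ᵥ (P *ᵥ x) < 0 := by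
  rintro ⟨P, hP, hsymm, hV⟩
  have hc : 0 < P 1 1 := hP.diag_pos
  have hdet : 0 < P.det := hP.det_pos
  have hb : P 1 0 = P 0 1 := congrFun (congrFun hsymm 0) 1
  rw [det_fin_two, hb] at hdet
  -- The minimum of `V` over the second coordinate is `det P / P 1 1` times the first one squared.
  have key : ∀ y w : ℝ,
      ![y, w] ⬝ᵥ (P *ᵥ ![y, w]) - ![P 1 1, -P 0 1] ⬝ᵥ (P *ᵥ ![P 1 1, -P 0 1]) < 0 →
        y ^ 2 < P 1 1 ^ 2 := by
    intro y w hlt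
    simp only [dotProduct, mulVec, Fin.sum_univ_two, cons_val_zero, cons_val_one, hb] at hlt
    refine lt_of_mul_lt_mul_left ?_ hdet.le
    nlinarith [mul_neg_of_pos_of_neg hc hlt, sq_nonneg (P 0 1 * y + P 1 1 * w)]
  have hx : ![P 1 1, -P 0 1] ≠ 0 := fun h0 => hc.ne' (congrFun h0 0)
  have first_coord : ∀ A ∈ ({!![1, h; -1.5 * h, 1], !![1, -h; 1.5 * h, 1]} :
      Set (Matrix (Fin 2) (Fin 2) ℝ)), (A 0 0 * P 1 1 - A 0 1 * P 0 1) ^ 2 < P 1 1 ^ 2 := by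
    intro A hA
    obtain ⟨u, hu⟩ := hV _ hx A hA
    refine key _ (A 1 0 * P 1 1 - A 1 1 * P 0 1 + u * h) ?_
    convert hu using 4 <;> ext i <;> fin_cases i <;>
      simp [sub_eq_add_neg]
  have h₁ := first_coord _ (Set.mem_insert _ _)
  have h₂ := first_coord _ (Set.mem_insert_of_mem _ rfl)
  simp only [of_apply, cons_val', cons_val_zero, cons_val_one] at h₁ h₂
  nlinarith [sq_nonneg (h * P 0 1)]
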